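/- arXiv:1803.05433 — 2 statements merged into one kernel-verified Lean document; each statement's English description precedes it below -/
import Mathlib

section
/- Let μ be a p×p interval matrix. Then μ is a full-rank interval matrix if and only if, for any two vertex matrices A₁ and A₂ of μ of even type, det(A₁) · det(A₂) > 0. (Here, since every entry of μ is a bounded interval, every vertex matrix of μ is a real matrix.) -/
/-- `A` is a vertex matrix of the interval matrix with left endpoints `m` and right
endpoints `M`: every entry of `A` is an endpoint of the corresponding interval. -/
def IsVertexMat {p q : ℕ} (m M A : Matrix (Fin p) (Fin q) ℝ) : Prop :=
  ∀ i j, A i j = m i j ∨ A i j = M i j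

/-- A vertex matrix `A` of the interval matrix `([m i j, M i j])` is of even type: for
every `2 × 2` submatrix, either some of the four entries of the interval matrix is
constant (i.e. `m = M` there), or the number of the four entries of `A` equal to the left
endpoint of the corresponding interval is even. -/
def IsEvenType {p q : ℕ} (m M A : Matrix (Fin p) (Fin q) ℝ) : Prop :=
  ∀ i1 i2 j1 j2, i1 ≠ i2 → j1 ≠ j2 →
    ((m i1 j1 = M i1 j1 ∨ m i1 j2 = M i1 j2 ∨ m i2 j1 = M i2 j1 ∨ m i2 j2 = M i2 j2) ∨
     Even ((if A i1 j1 = m i1 j1 then 1 else 0) + (if A i1 j2 = m i1 j2 then 1 else 0) +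
           (if A i2 j1 = m i2 j1 then 1 else 0) + (if A i2 j2 = m i2 j2 then (1 : ℕ) else 0)))

open Matrix in
/-- A sign condition on the determinant which holds for all choices of rows among two given ones
also holds when the rows lie in the segments between them. -/
theorem mul_det_pos_of_mem_segment {n : Type*} [Fintype n] [DecidableEq n]
    {a b : Matrix n n ℝ} {c : ℝ}
    (h : ∀ B : Matrix n n ℝ, (∀ i, B i = a i ∨ B i = b i) → 0 < c * B.det)
    (B : Matrix n n ℝ) (hB : ∀ i, B i ∈ segment ℝ (a i) (b i)) : 0 < c * B.det := by
  suffices H : ∀ (S : Finset n) (B : Matrix n n ℝ), (∀ i ∈ S, B i ∈ segment ℝ (a i) (b i)) →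
      (∀ i ∉ S, B i = a i ∨ B i = b i) → 0 < c * B.det from
    H Finset.univ B (fun i _ => hB i) (by simp)
  intro S
  induction S using Finset.induction_on with
  | empty => exact fun B _ hB => h B fun i => hB i (by simp)
  | insert k S hk ih =>
    intro B hS hSc
    have key : ∀ v, v = a k ∨ v = b k → 0 < c * (B.updateRow k v).det := by
      intro v hv
      refine ih _ (fun i hi => ?_) (fun i hi => ?_)
      · have hik : i ≠ k := fun e => hk (e ▸ hi)
        rw [updateRow_ne hik]
        exact hS i (Finset.mem_insert_of_mem hi)
      · rcases eq_or_ne i k with rfl | hik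
        · rwa [updateRow_self]
        · rw [updateRow_ne hik]
          exact hSc i (by simp [hik, hi])
    obtain ⟨s, t, hs, ht, hst, hrow⟩ := hS k (Finset.mem_insert_self k S)
    have hdet : B.det = s * (B.updateRow k (a k)).det + t * (B.updateRow k (b k)).det := by
      rw [← det_updateRow_smul, ← det_updateRow_smul, ← det_updateRow_add, hrow, updateRow_eq_self]
    have ha := key (a k) (Or.inl rfl)
    have hb := key (b k) (Or.inr rfl)
    rw [hdet]
    rcases hs.eq_or_lt with rfl | hs
    · obtain rfl : t = 1 := by linarith
      simpa using hb
    · nlinarith [mul_pos hs ha, mul_nonneg ht hb.le]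

/-- The vertex of the box `[m, M]` minimizing the scalar product of each row with `x`. -/
noncomputable def minVertex {p q : ℕ} (m M : Matrix (Fin p) (Fin q) ℝ) (x : Fin q → ℝ) :
    Matrix (Fin p) (Fin q) ℝ :=
  fun i j => if 0 ≤ x j then m i j else M i j

theorem isVertexMat_of_rows {p q : ℕ} {m M B : Matrix (Fin p) (Fin q) ℝ} {x : Fin q → ℝ}
    (hB : ∀ i, B i = minVertex m M x i ∨ B i = minVertex M m x i) : IsVertexMat m M B := by
  intro i j
  rcases hB i with h | h <;> rw [h] <;> unfold minVertex <;> split_ifs <;> simp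

theorem isEvenType_of_rows {p q : ℕ} {m M B : Matrix (Fin p) (Fin q) ℝ} {x : Fin q → ℝ}
    (hB : ∀ i, B i = minVertex m M x i ∨ B i = minVertex M m x i) : IsEvenType m M B := by
  intro i₁ i₂ j₁ j₂ _ _
  by_cases hc : m i₁ j₁ = M i₁ j₁ ∨ m i₁ j₂ = M i₁ j₂ ∨ m i₂ j₁ = M i₂ j₁ ∨ m i₂ j₂ = M i₂ j₂
  · exact Or.inl hc
  · right
    push Not at hc
    obtain ⟨h₁, h₂, h₃, h₄⟩ := hc
    rcases hB i₁ with e₁ | e₁ <;> rcases hB i₂ with e₂ | e₂ <;>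
      rw [e₁, e₂] <;> unfold minVertex <;> by_cases hx₁ : 0 ≤ x j₁ <;> by_cases hx₂ : 0 ≤ x j₂ <;>
      simp only [hx₁, hx₂, if_true, if_false, h₁.symm, h₂.symm, h₃.symm, h₄.symm] <;> decide

/-- If the rows of `A` lie in the box `[m, M]`, then in each segment between opposite extremal
vertices there is a row having the same scalar product with `x`. -/
theorem exists_mem_segment_dotProduct_eq {p q : ℕ} {m M A : Matrix (Fin p) (Fin q) ℝ}
    (hA : ∀ i j, A i j ∈ Set.Icc (m i j) (M i j)) (x : Fin q → ℝ) (i : Fin p) :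
    ∃ w ∈ segment ℝ (minVertex m M x i) (minVertex M m x i), w ⬝ᵥ x = A i ⬝ᵥ x := by
  have h₁ : minVertex m M x i ⬝ᵥ x ≤ A i ⬝ᵥ x := by
    refine Finset.sum_le_sum fun j _ => ?_
    unfold minVertex
    split_ifs with h
    · exact mul_le_mul_of_nonneg_right (hA i j).1 h
    · exact mul_le_mul_of_nonpos_right (hA i j).2 (not_le.mp h).le
  have h₂ : A i ⬝ᵥ x ≤ minVertex M m x i ⬝ᵥ x := by
    refine Finset.sum_le_sum fun j _ => ?_
    unfold minVertex
    split_ifs with h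
    · exact mul_le_mul_of_nonneg_right (hA i j).2 h
    · exact mul_le_mul_of_nonpos_right (hA i j).1 (not_le.mp h).le
  have hmem : A i ⬝ᵥ x ∈ segment ℝ (minVertex m M x i ⬝ᵥ x) (minVertex M m x i ⬝ᵥ x) := by
    rw [segment_eq_Icc (h₁.trans h₂)]
    exact ⟨h₁, h₂⟩
  obtain ⟨s, t, hs, ht, hst, h⟩ := hmem
  refine ⟨_, ⟨s, t, hs, ht, hst, rfl⟩, ?_⟩
  rw [add_dotProduct, smul_dotProduct, smul_dotProduct, h]

theorem Matrix.rank_eq_iff_det_ne_zero {p : ℕ} (A : Matrix (Fin p) (Fin p) ℝ) :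
    A.rank = p ↔ A.det ≠ 0 := by
  constructor
  · intro h hdet
    obtain ⟨x, hx, hAx⟩ := Matrix.exists_mulVec_eq_zero_iff.mpr hdet
    have hker : LinearMap.ker A.mulVecLin = ⊥ := by
      have := A.mulVecLin.finrank_range_add_finrank_ker
      rw [Module.finrank_fin_fun] at this
      change A.rank + _ = p at this
      exact Submodule.finrank_eq_zero.mp (by omega)
    exact hx ((LinearMap.ker_eq_bot'.mp hker) x hAx)
  · intro h
    simpa using Matrix.rank_of_isUnit A ((Matrix.isUnit_iff_isUnit_det A).mpr h.isUnit)

/-- The determinant has constant sign on a convex set of nonsingular matrices. -/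
theorem Convex.det_mul_det_pos {n : Type*} [Fintype n] [DecidableEq n]
    {s : Set (Matrix n n ℝ)} (hs : Convex ℝ s) (h : ∀ A ∈ s, A.det ≠ 0)
    {A B : Matrix n n ℝ} (hA : A ∈ s) (hB : B ∈ s) : 0 < A.det * B.det := by
  have hord := (hs.isPreconnected.image Matrix.det
    (Continuous.matrix_det continuous_id).continuousOn).ordConnected
  have hz : (0 : ℝ) ∉ Matrix.det '' s := fun ⟨C, hC, h0⟩ => h C hC h0
  have hA' := Set.mem_image_of_mem Matrix.det hA
  have hB' := Set.mem_image_of_mem Matrix.det hB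
  by_contra hneg
  rcases mul_nonpos_iff.mp (not_lt.mp hneg) with ⟨h₁, h₂⟩ | ⟨h₁, h₂⟩
  · exact hz (hord.out hB' hA' ⟨h₂, h₁⟩)
  · exact hz (hord.out hA' hB' ⟨h₁, h₂⟩)

/-- **Rohn's theorem restated via vertex matrices.** A `p × p` interval matrix
`μ = ([m i j, M i j])` is full-rank iff for any two vertex matrices `A₁, A₂` of `μ` of even
type, `det A₁ · det A₂ > 0`. -/
theorem rohn_vertex_matrices (p : ℕ) (m M : Matrix (Fin p) (Fin p) ℝ)
    (hmM : ∀ i j, m i j ≤ M i j) :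
    (∀ A : Matrix (Fin p) (Fin p) ℝ,
        (∀ i j, A i j ∈ Set.Icc (m i j) (M i j)) → A.rank = p) ↔
    (∀ A₁ A₂ : Matrix (Fin p) (Fin p) ℝ,
        IsVertexMat m M A₁ → IsEvenType m M A₁ →
        IsVertexMat m M A₂ → IsEvenType m M A₂ →
        0 < A₁.det * A₂.det) := by
  simp only [Matrix.rank_eq_iff_det_ne_zero]
  constructor
  · intro h A₁ A₂ hA₁ _ hA₂ _
    have hconv : Convex ℝ {A : Matrix (Fin p) (Fin p) ℝ | ∀ i j, A i j ∈ Set.Icc (m i j) (M i j)} := by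
      intro A hA B hB s t hs ht hst i j
      exact convex_Icc (m i j) (M i j) (hA i j) (hB i j) hs ht hst
    have hbox : ∀ A, IsVertexMat m M A → ∀ i j, A i j ∈ Set.Icc (m i j) (M i j) := by
      intro A hA i j
      rcases hA i j with e | e <;> simp [e, hmM i j]
    exact hconv.det_mul_det_pos h (hbox A₁ hA₁) (hbox A₂ hA₂)
  · intro h A hA hdet
    obtain ⟨x, hx, hAx⟩ := Matrix.exists_mulVec_eq_zero_iff.mpr hdet
    choose B hB hBx using exists_mem_segment_dotProduct_eq hA x
    have hBdet : Matrix.det B = 0 :=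
      Matrix.exists_mulVec_eq_zero_iff.mp ⟨x, hx, (funext hBx).trans hAx⟩
    have hpos := mul_det_pos_of_mem_segment (c := (minVertex m M x).det)
      (fun C hC => h _ C (isVertexMat_of_rows fun _ => Or.inl rfl)
        (isEvenType_of_rows fun _ => Or.inl rfl) (isVertexMat_of_rows hC)
        (isEvenType_of_rows hC)) B hB
    simp [hBdet] at hpos
end

section
/- Let ρ be a p×p general closed interval matrix all of whose entries are constant or half-bounded. Then ρ is full-rank if and only if det(ρ̄) ≠ 0 and, for every s ≥ 1 and every choice of positions (i₁,j₁), …, (i_s,j_s) ∈ {1,…,p}×{1,…,p} with i₁,…,i_s distinct, j₁,…,j_s distinct, and ρ_{i₁,j₁}, …, ρ_{i_s,j_s} all half-bounded, one has (−1)^{i₁+j₁+ ĩ₂+ j̃₂ + … + ĩ_s + j̃_s + χ((i₁,j₁),…,(i_s,j_s))} · det(ρ̄) · det(ρ̄_{î₁…î_s, ĵ₁…ĵ_s}) ≥ 0, where ρ̄_{î₁…î_s, ĵ₁…ĵ_s} is the submatrix of ρ̄ obtained by deleting rows i₁,…,i_s and columns j₁,…,j_s. -/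
open scoped Classical

/-- A real matrix `A` is contained in the (general closed interval) matrix `μ` of subsets
of `ℝ` iff each entry of `A` belongs to the corresponding entry of `μ`. -/
def Contains {I J : Type*} (μ : Matrix I J (Set ℝ)) (A : Matrix I J ℝ) : Prop :=
  ∀ i j, A i j ∈ μ i j

/-- `μ` is a general closed interval matrix: every entry is a closed connected nonempty
subset of `ℝ`. -/
def GCIM {I J : Type*} (μ : Matrix I J (Set ℝ)) : Prop :=
  ∀ i j, IsClosed (μ i j) ∧ (μ i j).Nonempty ∧ IsPreconnected (μ i j)

/-- An entry is constant iff it is a singleton. -/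
def IsConst (S : Set ℝ) : Prop := ∃ a : ℝ, S = {a}

/-- A left-bounded entry `[a, +∞)`. -/
def IsLeftB (S : Set ℝ) : Prop := ∃ a : ℝ, S = Set.Ici a

/-- A right-bounded entry `(-∞, a]`. -/
def IsRightB (S : Set ℝ) : Prop := ∃ a : ℝ, S = Set.Iic a

/-- The real number associated to an entry which is a singleton, a bounded interval, or a
half-bounded interval: the left endpoint if the entry is bounded below (`{a} ↦ a`,
`[a,b] ↦ a`, `[a,+∞) ↦ a`) and otherwise the right endpoint (`(-∞,b] ↦ b`).  Applied
entrywise to a matrix `ρ` with constant or half-bounded entries this realizes `ρ̄`. -/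
noncomputable def pick (S : Set ℝ) : ℝ := if BddBelow S then sInf S else sSup S

/-- Determinant of a square real matrix whose rows and columns are indexed by (possibly
different) finite linear orders of the same cardinality, the two index types being
identified with `Fin n` by the unique monotone bijections.  This realizes the determinant
of a submatrix of a matrix obtained by deleting rows and columns (the determinant of the
`0 × 0` matrix being `1`). -/
noncomputable def gdet {I J : Type*} [Fintype I] [Fintype J] [LinearOrder I] [LinearOrder J]
    (A : Matrix I J ℝ) : ℝ :=
  ∑ e : I ≃ J,
    ((Equiv.Perm.sign ((monoEquivOfFin I rfl).toEquiv.trans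
      (e.trans (monoEquivOfFin J (Fintype.card_congr e.symm)).toEquiv.symm)) : ℤ) : ℝ) *
    ∏ i, A i (e i)

/-- The sign attached to an entry: `-1` if it is right-bounded and `1` otherwise. -/
noncomputable def boundSign (S : Set ℝ) : ℝ := if IsRightB S then -1 else 1

theorem gdet_eq_det {I J : Type*} [Fintype I] [Fintype J] [LinearOrder I] [LinearOrder J]
    {n : ℕ} (f : Fin n ≃o I) (g : Fin n ≃o J) (A : Matrix I J ℝ) :
    gdet A = (A.submatrix f g).det := by
  obtain rfl : n = Fintype.card I := by simpa using Fintype.card_congr f.toEquiv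
  rw [← Matrix.det_transpose, Matrix.det_apply', gdet]
  refine Fintype.sum_equiv (Equiv.equivCongr f.toEquiv.symm g.toEquiv.symm) _ _ fun e => ?_
  have hf : monoEquivOfFin I rfl = f := Subsingleton.elim _ _
  have hg : monoEquivOfFin J (Fintype.card_congr e.symm) = g := Subsingleton.elim _ _
  rw [hf, hg]
  congr 1
  refine Fintype.prod_equiv f.symm.toEquiv _ _ fun i => ?_
  simp

theorem gdet_comp_orderIso {I J I' J' : Type*} [Fintype I] [Fintype J] [Fintype I'] [Fintype J']
    [LinearOrder I] [LinearOrder J] [LinearOrder I'] [LinearOrder J']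
    (f : I' ≃o I) (g : J' ≃o J) (A : Matrix I J ℝ) :
    gdet (A.submatrix f g) = gdet A := by
  by_cases h : Fintype.card I = Fintype.card J
  · have hI : Fintype.card I' = Fintype.card I := Fintype.card_congr f.toEquiv
    have hJ : Fintype.card J' = Fintype.card I := (Fintype.card_congr g.toEquiv).trans h.symm
    rw [gdet_eq_det (monoEquivOfFin I' hI) (monoEquivOfFin J' hJ),
      gdet_eq_det ((monoEquivOfFin I' hI).trans f) ((monoEquivOfFin J' hJ).trans g)]
    rfl
  · have h₁ : IsEmpty (I ≃ J) := ⟨fun e => h (Fintype.card_congr e)⟩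
    have h₂ : IsEmpty (I' ≃ J') :=
      ⟨fun e => h (Fintype.card_congr (f.toEquiv.symm.trans (e.trans g.toEquiv)))⟩
    simp [gdet]

theorem val_sub_card_lt_succ {s p : ℕ} (r : Fin (s + 1) → Fin (p + 1)) (r' : Fin s → Fin p)
    (h : ∀ t, (r 0).succAbove (r' t) = r t.succ) (t : Fin s) :
    (r t.succ : ℕ) - (Finset.univ.filter fun u => u < t.succ ∧ r u < r t.succ).card =
      (r' t : ℕ) - (Finset.univ.filter fun u => u < t ∧ r' u < r' t).card := by
  have hlt : ∀ u, r u.succ < r t.succ ↔ r' u < r' t := fun u => by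
    rw [← h, ← h, Fin.succAbove_lt_succAbove_iff]
  have hval : (r t.succ : ℕ) = if r 0 < r t.succ then (r' t : ℕ) + 1 else r' t := by
    rw [← h]
    rcases lt_or_ge (r' t).castSucc (r 0) with h' | h'
    · rw [Fin.succAbove_of_castSucc_lt _ _ h', if_neg h'.not_gt]
      rfl
    · rw [Fin.succAbove_of_le_castSucc _ _ h', if_pos (h'.trans_lt Fin.castSucc_lt_succ)]
      rfl
  rw [Fin.card_filter_univ_succ]
  simp only [Fin.succ_lt_succ_iff, hlt, Fin.succ_pos, true_and]
  split_ifs at hval ⊢ <;> omega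

/-- Order isomorphism between the complements of the ranges of `r'` and `r`, where `r'` is
obtained from the tail of `r` by skipping the index `r 0`. -/
noncomputable def complOrderIso {s p : ℕ} (r : Fin (s + 1) → Fin (p + 1)) (r' : Fin s → Fin p)
    (h : ∀ t, (r 0).succAbove (r' t) = r t.succ) :
    {i : Fin p // ∀ t, r' t ≠ i} ≃o {i : Fin (p + 1) // ∀ t, r t ≠ i} :=
  StrictMono.orderIsoOfSurjective
    (fun i => ⟨(r 0).succAbove i.1, fun t => by
      refine Fin.cases (Fin.succAbove_ne _ _).symm (fun t => ?_) t
      rw [← h]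
      exact fun e => i.2 t (Fin.succAbove_right_injective e)⟩)
    (fun _ _ hij => (Fin.strictMono_succAbove (r 0)) hij)
    (fun i => by
      obtain ⟨z, hz⟩ := Fin.exists_succAbove_eq (i.2 0).symm
      refine ⟨⟨z, fun t e => i.2 t.succ ?_⟩, Subtype.ext hz⟩
      rw [← h, e, hz])

/-- Iterated Laplace expansion along rows which are multiples of distinct basis vectors. -/
theorem det_of_basis_rows {s : ℕ} : ∀ {p : ℕ} (N : Matrix (Fin p) (Fin p) ℝ)
    (r c : Fin s → Fin p) (v : Fin s → ℝ), Function.Injective r → Function.Injective c →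
    (∀ t j, N (r t) j = if j = c t then v t else 0) →
    N.det = (-1 : ℝ) ^ (∑ t : Fin s,
        (((r t : ℕ) - (Finset.univ.filter fun u => u < t ∧ r u < r t).card) +
          ((c t : ℕ) - (Finset.univ.filter fun u => u < t ∧ c u < c t).card))) *
      (∏ t, v t) *
      gdet (Matrix.of fun (i : {i : Fin p // ∀ t, r t ≠ i})
        (j : {j : Fin p // ∀ t, c t ≠ j}) => N i.1 j.1) := by
  induction s with
  | zero =>
    intro p N r c v _ _ _
    have e : ∀ r : Fin 0 → Fin p, ∃ f : Fin p ≃o {i : Fin p // ∀ t, r t ≠ i},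
        ∀ i, (f i).1 = i := fun r =>
      ⟨StrictMono.orderIsoOfSurjective (fun i => ⟨i, fun t => t.elim0⟩) (fun _ _ h => h)
        (fun i => ⟨i.1, rfl⟩), fun _ => rfl⟩
    obtain ⟨f, hf⟩ := e r
    obtain ⟨g, hg⟩ := e c
    rw [gdet_eq_det f g]
    simp only [Finset.univ_eq_empty, Finset.sum_empty, Finset.prod_empty, pow_zero, one_mul]
    congr 1
    ext i j
    simp [hf, hg]
  | succ s ih =>
    intro p N r c v hr hc hN
    obtain _ | p := p
    · exact (r 0).elim0
    have hne : ∀ {r : Fin (s + 1) → Fin (p + 1)}, Function.Injective r →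
        ∃ r' : Fin s → Fin p, ∀ t, (r 0).succAbove (r' t) = r t.succ := fun {r} hr => by
      choose r' h using fun t : Fin s =>
        Fin.exists_succAbove_eq (hr.ne (Fin.succ_ne_zero t))
      exact ⟨r', h⟩
    obtain ⟨r', hr'⟩ := hne hr
    obtain ⟨c', hc'⟩ := hne hc
    have hinj : ∀ {r : Fin (s + 1) → Fin (p + 1)} {r' : Fin s → Fin p}, Function.Injective r →
        (∀ t, (r 0).succAbove (r' t) = r t.succ) → Function.Injective r' :=
      fun {r r'} hr h a b hab => by
        apply Fin.succ_injective
        apply hr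
        rw [← h, ← h, hab]
    have key := ih (N.submatrix (r 0).succAbove (c 0).succAbove) r' c' (fun t => v t.succ)
      (hinj hr hr') (hinj hc hc') fun t j => by
        rw [Matrix.submatrix_apply, hr', hN, ← hc']
        simp only [Fin.succAbove_right_inj]
    rw [Matrix.det_succ_row N (r 0), Finset.sum_eq_single (c 0), key, Fin.sum_univ_succ,
      Fin.prod_univ_succ, hN, if_pos rfl]
    · rw [← gdet_comp_orderIso (complOrderIso r r' hr') (complOrderIso c c' hc')]
      simp only [val_sub_card_lt_succ r r' hr', val_sub_card_lt_succ c c' hc', Fin.not_lt_zero,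
        false_and, Finset.filter_false, Finset.card_empty, Nat.sub_zero, pow_add]
      have hg : Matrix.of (fun (i : {i : Fin p // ∀ t, r' t ≠ i})
            (j : {j : Fin p // ∀ t, c' t ≠ j}) =>
            N.submatrix (r 0).succAbove (c 0).succAbove i.1 j.1) =
          (Matrix.of fun (i : {i : Fin (p + 1) // ∀ t, r t ≠ i})
            (j : {j : Fin (p + 1) // ∀ t, c t ≠ j}) => N i.1 j.1).submatrix
            (complOrderIso r r' hr') (complOrderIso c c' hc') := rfl
      rw [hg]
      ring
    · intro j _ hj
      rw [hN, if_neg hj]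
      simp
    · simp

/-- Signed expansion in the form used by the full-rank criterion. -/
theorem det_of_boundSign_rows {p s : ℕ} (ρ : Matrix (Fin p) (Fin p) (Set ℝ))
    (r c : Fin s → Fin p) (hr : Function.Injective r) (hc : Function.Injective c)
    (N : Matrix (Fin p) (Fin p) ℝ)
    (hN : ∀ t j, N (r t) j = if j = c t then boundSign (ρ (r t) (c t)) else 0)
    (hN' : ∀ i, (∀ t, r t ≠ i) → ∀ j, N i j = pick (ρ i j)) (d : ℝ) :
    d * N.det = (-1 : ℝ) ^
             ((∑ t : Fin s,
                (((r t : ℕ) - (Finset.univ.filter fun u => u < t ∧ r u < r t).card) +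
                 ((c t : ℕ) - (Finset.univ.filter fun u => u < t ∧ c u < c t).card))) +
              (Finset.univ.filter fun t => IsRightB (ρ (r t) (c t))).card) *
           d *
           gdet (Matrix.of fun (i : {i : Fin p // ∀ t, r t ≠ i})
               (j : {j : Fin p // ∀ t, c t ≠ j}) => pick (ρ i.1 j.1)) := by
  have hprod : ∏ t, boundSign (ρ (r t) (c t)) =
      (-1) ^ (Finset.univ.filter fun t => IsRightB (ρ (r t) (c t))).card := by
    simp [boundSign, Finset.prod_ite]
  have hg : (Matrix.of fun (i : {i : Fin p // ∀ t, r t ≠ i})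
      (j : {j : Fin p // ∀ t, c t ≠ j}) => N i.1 j.1) =
      Matrix.of fun (i : {i : Fin p // ∀ t, r t ≠ i})
        (j : {j : Fin p // ∀ t, c t ≠ j}) => pick (ρ i.1 j.1) := by
    ext i j
    exact hN' i.1 i.2 j.1
  rw [det_of_basis_rows N r c _ hr hc hN, hprod, hg, pow_add]
  ring

@[simp] theorem pick_singleton (a : ℝ) : pick {a} = a := by simp [pick]

@[simp] theorem pick_Ici (a : ℝ) : pick (Set.Ici a) = a := by simp [pick, bddBelow_Ici]

@[simp] theorem pick_Iic (a : ℝ) : pick (Set.Iic a) = a := by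
  simp [pick, not_bddBelow_Iic]

theorem not_isRightB_Ici (a : ℝ) : ¬ IsRightB (Set.Ici a) := fun ⟨b, h⟩ =>
  not_bddBelow_Iic b (h ▸ bddBelow_Ici)

theorem exists_eq_pick_add {S : Set ℝ} (hS : IsConst S ∨ IsLeftB S ∨ IsRightB S) {a : ℝ}
    (ha : a ∈ S) : ∃ x : ℝ, 0 ≤ x ∧ a = pick S + x * boundSign S ∧
      (x = 0 ∨ IsLeftB S ∨ IsRightB S) := by
  obtain ⟨b, rfl⟩ | ⟨b, rfl⟩ | ⟨b, rfl⟩ := hS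
  · exact ⟨0, le_rfl, by simpa using ha, Or.inl rfl⟩
  · refine ⟨a - b, sub_nonneg.2 ha, ?_, Or.inr (Or.inl ⟨b, rfl⟩)⟩
    simp [boundSign, not_isRightB_Ici]
  · refine ⟨b - a, sub_nonneg.2 ha, ?_, Or.inr (Or.inr ⟨b, rfl⟩)⟩
    have : IsRightB (Set.Iic b) := ⟨b, rfl⟩
    simp [boundSign, this]

theorem pick_mem {S : Set ℝ} (hS : IsConst S ∨ IsLeftB S ∨ IsRightB S) : pick S ∈ S := by
  obtain ⟨b, rfl⟩ | ⟨b, rfl⟩ | ⟨b, rfl⟩ := hS <;> simp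

theorem pick_add_mem {S : Set ℝ} (hS : IsLeftB S ∨ IsRightB S) {x : ℝ} (hx : 0 ≤ x) :
    pick S + x * boundSign S ∈ S := by
  obtain ⟨b, rfl⟩ | ⟨b, rfl⟩ := hS
  · simpa [boundSign, not_isRightB_Ici] using hx
  · have : IsRightB (Set.Iic b) := ⟨b, rfl⟩
    simpa [boundSign, this] using hx

/-- On a full-rank interval matrix the determinant has constant sign. -/
theorem det_mul_det_pos_of_fullRank {p : ℕ} {ρ : Matrix (Fin p) (Fin p) (Set ℝ)} (hρ : GCIM ρ)
    (hfull : ∀ A : Matrix (Fin p) (Fin p) ℝ, Contains ρ A → A.det ≠ 0)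
    {A B : Matrix (Fin p) (Fin p) ℝ} (hA : Contains ρ A) (hB : Contains ρ B) :
    0 < A.det * B.det := by
  have hconv : Convex ℝ {A : Matrix (Fin p) (Fin p) ℝ | Contains ρ A} := by
    intro A hA B hB a b ha hb hab i j
    exact (hρ i j).2.2.ordConnected.convex (hA i j) (hB i j) ha hb hab
  have hord := (hconv.isPreconnected.image _
    (Continuous.matrix_det continuous_id).continuousOn).ordConnected
  by_contra! hle
  have h0 : (0 : ℝ) ∈ Set.uIcc A.det B.det := by
    rw [Set.mem_uIcc]
    rcases le_total A.det 0 with h | h <;> rcases le_total B.det 0 with h' | h'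
    · rcases eq_or_lt_of_le h with h | h
      · exact absurd h (hfull A hA)
      · rcases eq_or_lt_of_le h' with h' | h'
        · exact absurd h' (hfull B hB)
        · nlinarith [mul_pos_of_neg_of_neg h h']
    · exact Or.inl ⟨h, h'⟩
    · exact Or.inr ⟨h', h⟩
    · rcases eq_or_lt_of_le h with h | h
      · exact absurd h.symm (hfull A hA)
      · rcases eq_or_lt_of_le h' with h' | h'
        · exact absurd h'.symm (hfull B hB)
        · nlinarith [mul_pos h h']
  obtain ⟨C, hC, hC0⟩ := hord.uIcc_subset ⟨A, hA, rfl⟩ ⟨B, hB, rfl⟩ h0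
  exact hfull C hC hC0

/-- If the determinant times `d` is positive on `ρ`, then it is nonnegative after replacing
rows by the asymptotic directions of half-bounded entries. -/
theorem det_basis_rows_nonneg {p s : ℕ} {ρ : Matrix (Fin p) (Fin p) (Set ℝ)}
    (hb : ∀ i j, IsConst (ρ i j) ∨ IsLeftB (ρ i j) ∨ IsRightB (ρ i j)) {d : ℝ}
    (hpos : ∀ A : Matrix (Fin p) (Fin p) ℝ, Contains ρ A → 0 < d * A.det)
    {r c : Fin s → Fin p}
    (hrc : ∀ t, IsLeftB (ρ (r t) (c t)) ∨ IsRightB (ρ (r t) (c t)))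
    (N : Matrix (Fin p) (Fin p) ℝ)
    (hN : ∀ t j, N (r t) j = if j = c t then boundSign (ρ (r t) (c t)) else 0)
    (hN' : ∀ i, (∀ t, r t ≠ i) → ∀ j, N i j = pick (ρ i j)) : 0 ≤ d * N.det := by
  let B : ℝ → Matrix (Fin p) (Fin p) ℝ := fun z => Matrix.of fun i j =>
    N i j + z * if ∃ t, r t = i then pick (ρ i j) else 0
  have hB0 : B 0 = N := by ext i j; simp [B]
  have hcont : Continuous fun z => d * (B z).det := by
    refine continuous_const.mul (Continuous.matrix_det ?_)
    exact continuous_matrix fun i j => by dsimp [B]; fun_prop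
  have hnonneg : ∀ z ∈ Set.Ioi (0 : ℝ), 0 ≤ d * (B z).det := by
    intro z (hz : 0 < z)
    let w : Fin p → ℝ := fun i => if ∃ t, r t = i then z⁻¹ else 1
    have hw : 0 < ∏ i, w i := Finset.prod_pos fun i _ => by
      dsimp [w]; split_ifs <;> positivity
    have hmem : Contains ρ (Matrix.of fun i j => w i * B z i j) := by
      intro i j
      by_cases h : ∃ t, r t = i
      · obtain ⟨t, rfl⟩ := h
        have hex : ∃ u, r u = r t := ⟨t, rfl⟩
        simp only [Matrix.of_apply, w, B, if_pos hex, hN]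
        split_ifs with hj
        · subst hj
          have := pick_add_mem (hrc t) (inv_nonneg.2 hz.le)
          convert this using 1
          field_simp
          ring
        · convert pick_mem (hb (r t) j) using 1
          field_simp
          ring
      · simp only [Matrix.of_apply, w, B, if_neg h, mul_zero, add_zero, one_mul]
        rw [hN' i (not_exists.1 h)]
        exact pick_mem (hb i j)
    have h := hpos _ hmem
    rw [Matrix.det_mul_column] at h
    by_contra! hneg
    nlinarith [mul_pos_of_neg_of_neg hneg (neg_lt_zero.2 hw)]
  have hmem : (0 : ℝ) ∈ closure (Set.Ioi (0 : ℝ)) := by simp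
  have := (isClosed_Ici.preimage hcont).closure_subset_iff (s := Set.Ioi (0 : ℝ)) |>.2 hnonneg hmem
  simpa [hB0] using this

/-- The matrix whose row `i` is the signed basis vector of index `q i` when `q i` is defined, and
otherwise agrees with the row of `A` if `i ∈ T` and with the row of endpoints of `ρ` if not. -/
noncomputable def mixedMatrix {p : ℕ} (ρ : Matrix (Fin p) (Fin p) (Set ℝ))
    (A : Matrix (Fin p) (Fin p) ℝ) (T : Finset (Fin p)) (q : Fin p → Option (Fin p)) :
    Matrix (Fin p) (Fin p) ℝ :=
  Matrix.of fun i => match q i with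
    | some k => Pi.single k (boundSign (ρ i k))
    | none => if i ∈ T then A i else fun j => pick (ρ i j)

theorem det_mixedMatrix_insert {p : ℕ} {ρ : Matrix (Fin p) (Fin p) (Set ℝ)}
    {A : Matrix (Fin p) (Fin p) ℝ} {T : Finset (Fin p)} {q : Fin p → Option (Fin p)}
    {i : Fin p} (hi : i ∉ T) (hq : q i = none) {x : Fin p → ℝ}
    (hx : ∀ j, A i j = pick (ρ i j) + x j * boundSign (ρ i j)) :
    (mixedMatrix ρ A (insert i T) q).det = (mixedMatrix ρ A T q).det +
      ∑ j, x j * (mixedMatrix ρ A T (Function.update q i (some j))).det := by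
  have hrow : A i = (fun j => pick (ρ i j)) + ∑ j, x j • Pi.single j (boundSign (ρ i j)) := by
    ext k
    simp [hx, Finset.sum_apply, Pi.single_apply]
  have h₁ : mixedMatrix ρ A (insert i T) q = (mixedMatrix ρ A T q).updateRow i (A i) := by
    ext k l
    by_cases hk : k = i
    · subst hk; simp [mixedMatrix, hq]
    · simp [mixedMatrix, hk]
  have h₂ : (mixedMatrix ρ A T q).updateRow i (fun j => pick (ρ i j)) = mixedMatrix ρ A T q := by
    ext k l
    by_cases hk : k = i
    · subst hk; simp [mixedMatrix, hq, hi]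
    · simp [hk]
  have h₃ : ∀ j, (mixedMatrix ρ A T q).updateRow i (Pi.single j (boundSign (ρ i j))) =
      mixedMatrix ρ A T (Function.update q i (some j)) := by
    intro j
    ext k l
    by_cases hk : k = i
    · subst hk; simp [mixedMatrix]
    · simp [mixedMatrix, hk]
  have hsum : ∀ S : Finset (Fin p), ((mixedMatrix ρ A T q).updateRow i
      ((fun j => pick (ρ i j)) + ∑ j ∈ S, x j • Pi.single j (boundSign (ρ i j)))).det =
      (mixedMatrix ρ A T q).det +
        ∑ j ∈ S, x j * (mixedMatrix ρ A T (Function.update q i (some j))).det := by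
    intro S
    induction S using Finset.induction_on with
    | empty => simp [h₂]
    | insert j S hj ih =>
      rw [Finset.sum_insert hj, Finset.sum_insert hj, add_left_comm, Matrix.det_updateRow_add, ih,
        Matrix.det_updateRow_smul, h₃]
      ring
  rw [h₁, hrow, hsum]

theorem mixedMatrix_nonneg {p : ℕ} {ρ : Matrix (Fin p) (Fin p) (Set ℝ)}
    (hb : ∀ i j, IsConst (ρ i j) ∨ IsLeftB (ρ i j) ∨ IsRightB (ρ i j)) {d : ℝ}
    {A : Matrix (Fin p) (Fin p) ℝ} (hA : Contains ρ A)
    (hbase : ∀ q : Fin p → Option (Fin p),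
      (∀ i j, q i = some j → IsLeftB (ρ i j) ∨ IsRightB (ρ i j)) →
      0 ≤ d * (mixedMatrix ρ A ∅ q).det) (T : Finset (Fin p)) :
    (∀ q : Fin p → Option (Fin p),
      (∀ i j, q i = some j → IsLeftB (ρ i j) ∨ IsRightB (ρ i j)) →
      0 ≤ d * (mixedMatrix ρ A T q).det) ∧
    d * (mixedMatrix ρ A ∅ fun _ => none).det ≤ d * (mixedMatrix ρ A T fun _ => none).det := by
  induction T using Finset.induction_on with
  | empty => exact ⟨hbase, le_rfl⟩
  | insert i T hi ih =>
    choose x hx₀ hx hx₁ using fun j => exists_eq_pick_add (hb i j) (hA i j)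
    have hstep : ∀ q : Fin p → Option (Fin p),
        (∀ i j, q i = some j → IsLeftB (ρ i j) ∨ IsRightB (ρ i j)) → q i = none →
        d * (mixedMatrix ρ A T q).det ≤ d * (mixedMatrix ρ A (insert i T) q).det := by
      intro q hq hqi
      rw [det_mixedMatrix_insert hi hqi hx, mul_add, Finset.mul_sum]
      refine le_add_of_nonneg_right (Finset.sum_nonneg fun j _ => ?_)
      rcases hx₁ j with h | h
      · simp [h]
      · rw [mul_left_comm]
        refine mul_nonneg (hx₀ j) (ih.1 _ fun k l hkl => ?_)
        by_cases hk : k = i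
        · subst hk
          obtain rfl : j = l := by simpa using hkl
          exact h
        · exact hq k l (by simpa [hk] using hkl)
    refine ⟨fun q hq => ?_, ih.2.trans (hstep _ (by simp) rfl)⟩
    cases hqi : q i with
    | none => exact (ih.1 q hq).trans (hstep q hq hqi)
    | some k =>
      have : mixedMatrix ρ A (insert i T) q = mixedMatrix ρ A T q := by
        ext a b
        by_cases ha : a = i
        · subst ha; simp [mixedMatrix, hqi]
        · simp [mixedMatrix, ha]
      rw [this]
      exact ih.1 q hq

theorem det_mixedMatrix_eq_zero {p : ℕ} {ρ : Matrix (Fin p) (Fin p) (Set ℝ)}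
    {A : Matrix (Fin p) (Fin p) ℝ} {T : Finset (Fin p)} {q : Fin p → Option (Fin p)}
    {i k j : Fin p} (hik : i ≠ k) (hi : q i = some j) (hk : q k = some j) :
    (mixedMatrix ρ A T q).det = 0 := by
  have hrow : ∀ l, q l = some j →
      mixedMatrix ρ A T q l = boundSign (ρ l j) • Pi.single j (1 : ℝ) := by
    intro l hl
    ext m
    simp [mixedMatrix, hl, Pi.single_apply]
  have h : mixedMatrix ρ A T q = (((mixedMatrix ρ A T q).updateRow i
      (boundSign (ρ i j) • Pi.single j (1 : ℝ))).updateRow k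
      (boundSign (ρ k j) • Pi.single j (1 : ℝ))) := by
    rw [← hrow i hi, ← hrow k hk, Matrix.updateRow_eq_self, Matrix.updateRow_eq_self]
  rw [h, Matrix.det_updateRow_smul, Matrix.updateRow_comm _ hik, Matrix.det_updateRow_smul,
    Matrix.det_zero_of_row_eq hik (by simp [Matrix.updateRow_ne hik.symm]), mul_zero, mul_zero]

/-- **Full-rank criterion for matrices with constant or half-bounded entries.**
Let `ρ` be a `p × p` general closed interval matrix all of whose entries are constant or
half-bounded. Then `ρ` is full-rank iff `det ρ̄ ≠ 0` and, for every `s ≥ 1` and all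
positions `(i₁,j₁), …, (i_s,j_s)` (encoded by injective maps `r c : Fin s → Fin p`, with
`0`-based indices; the parity of the sign exponent agrees with the `1`-based one of the
paper) whose entries in `ρ` are all half-bounded,
`(-1) ^ (∑ₜ (ĩ_t + j̃_t) + χ) · det ρ̄ · det ρ̄_{rows/cols deleted} ≥ 0`, where
`ĩ_t = i_t - #{u < t | i_u < i_t}`, `j̃_t = j_t - #{u < t | j_u < j_t}` and `χ` is the
number of right-bounded entries among the selected ones. -/
theorem fullRank_iff_halfBounded (p : ℕ) (ρ : Matrix (Fin p) (Fin p) (Set ℝ))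
    (hρ : GCIM ρ)
    (hb : ∀ i j, IsConst (ρ i j) ∨ IsLeftB (ρ i j) ∨ IsRightB (ρ i j)) :
    (∀ A : Matrix (Fin p) (Fin p) ℝ, Contains ρ A → A.det ≠ 0) ↔
    ((Matrix.of fun i j => pick (ρ i j)).det ≠ 0 ∧
     ∀ s : ℕ, 1 ≤ s → ∀ r c : Fin s → Fin p,
       Function.Injective r → Function.Injective c →
       (∀ t, IsLeftB (ρ (r t) (c t)) ∨ IsRightB (ρ (r t) (c t))) →
       0 ≤ (-1 : ℝ) ^
             ((∑ t : Fin s,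
                (((r t : ℕ) - (Finset.univ.filter fun u => u < t ∧ r u < r t).card) +
                 ((c t : ℕ) - (Finset.univ.filter fun u => u < t ∧ c u < c t).card))) +
              (Finset.univ.filter fun t => IsRightB (ρ (r t) (c t))).card) *
           (Matrix.of fun i j => pick (ρ i j)).det *
           gdet (Matrix.of fun (i : {i : Fin p // ∀ t, r t ≠ i})
               (j : {j : Fin p // ∀ t, c t ≠ j}) => pick (ρ i.1 j.1))) := by
  have hmem : Contains ρ (Matrix.of fun i j => pick (ρ i j)) := fun i j => pick_mem (hb i j)
  constructor
  · intro hfull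
    refine ⟨hfull _ hmem, fun s _ r c hr hc hrc => ?_⟩
    let N : Matrix (Fin p) (Fin p) ℝ := Matrix.of fun i j =>
      if h : ∃ t, r t = i then
        if j = c h.choose then boundSign (ρ (r h.choose) (c h.choose)) else 0
      else pick (ρ i j)
    have hN : ∀ t j, N (r t) j = if j = c t then boundSign (ρ (r t) (c t)) else 0 := by
      intro t j
      have h : ∃ u, r u = r t := ⟨t, rfl⟩
      have ht : h.choose = t := hr h.choose_spec
      simp only [N, Matrix.of_apply, dif_pos h, ht]
    have hN' : ∀ i, (∀ t, r t ≠ i) → ∀ j, N i j = pick (ρ i j) := by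
      intro i hi j
      simp [N, hi]
    rw [← det_of_boundSign_rows ρ r c hr hc N hN hN']
    exact det_basis_rows_nonneg hb (fun A hA => det_mul_det_pos_of_fullRank hρ hfull hmem hA)
      hrc N hN hN'
  · rintro ⟨hd, H⟩ A hA hA0
    have hnone : ∀ B, (mixedMatrix ρ B ∅ fun _ => none) = Matrix.of fun i j => pick (ρ i j) := by
      intro B
      ext i j
      simp [mixedMatrix]
    have hall : (mixedMatrix ρ A Finset.univ fun _ => none) = A := by
      ext i j
      simp [mixedMatrix]
    have hle := (mixedMatrix_nonneg hb (d := (Matrix.of fun i j => pick (ρ i j)).det) hA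
      (fun q hq => ?_) Finset.univ).2
    · rw [hnone, hall, hA0, mul_zero] at hle
      exact absurd hle (not_le.2 (mul_self_pos.2 hd))
    by_cases hinj : ∀ i k j, q i = some j → q k = some j → i = k
    · let R : Finset (Fin p) := Finset.univ.filter fun i => (q i).isSome
      let r : Fin R.card → Fin p := R.orderEmbOfFin rfl
      have hr : Function.Injective r := (R.orderEmbOfFin rfl).injective
      have hsome : ∀ t, ∃ j, q (r t) = some j := fun t =>
        Option.isSome_iff_exists.1 (Finset.mem_filter.1 (R.orderEmbOfFin_mem rfl t)).2
      choose c hc using hsome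
      have hcinj : Function.Injective c := fun t u htu =>
        hr (hinj _ _ (c t) (hc t) (htu ▸ hc u))
      have hout : ∀ i, (∀ t, r t ≠ i) → q i = none := by
        intro i hi
        by_contra hne
        have hiR : i ∈ Set.range r := by
          rw [Finset.range_orderEmbOfFin]
          simpa [R, Option.isSome_iff_ne_none] using hne
        obtain ⟨t, ht⟩ := hiR
        exact hi t ht
      rcases Nat.eq_zero_or_pos R.card with h0 | hpos
      · have hq0 : q = fun _ => none := funext fun i => hout i fun t => (h0 ▸ t).elim0
        rw [hq0, hnone]
        exact mul_self_nonneg _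
      · rw [det_of_boundSign_rows ρ r c hr hcinj]
        · exact H R.card hpos r c hr hcinj fun t => hq _ _ (hc t)
        · intro t j
          simp [mixedMatrix, hc, Pi.single_apply]
        · intro i hi j
          simp [mixedMatrix, hout i hi]
    · push Not at hinj
      obtain ⟨i, k, j, hi, hk, hik⟩ := hinj
      rw [det_mixedMatrix_eq_zero hik hi hk, mul_zero]
end
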